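/- Let p be a prime and let P be an abelian group in which every element has order a power of p (a p-torsion abelian group). If the group Hom(ℤ/p, P) of group homomorphisms from the cyclic group of order p to P is finite, then P is isomorphic to a direct sum of finitely many groups, each of which is either a cyclic group ℤ/p^r for some r ≥ 1 or a Prüfer p-group ℤ(p^∞). -/

import Mathlib

/-- The rationals modulo the integers, `ℚ/ℤ`. -/
def QModZ : Type := ℚ ⧸ AddSubgroup.zmultiples (1 : ℚ)

noncomputable instance : AddCommGroup QModZ :=
  QuotientAddGroup.Quotient.addCommGroup _

/-- The Prüfer `p`-group `ℤ(p^∞)`, realized as the `p`-primary torsion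
subgroup of `ℚ/ℤ`. -/
noncomputable def PruferGroup (p : ℕ) [Fact p.Prime] : AddSubgroup QModZ :=
  AddCommGroup.primaryComponent QModZ p

theorem aux_baer (p : ℕ) [hp : Fact p.Prime] (A : Type*) [AddCommGroup A]
    (htor : ∀ x : A, ∃ n : ℕ, p ^ n • x = 0) (hdiv : ∀ x : A, ∃ y, p • y = x) :
    Module.Baer ℤ A := by
  have hpow : ∀ (k : ℕ) (x : A), ∃ y, p ^ k • y = x := by
    intro k
    induction k with
    | zero => intro x; exact ⟨x, by simp⟩
    | succ k ih =>
      intro x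
      obtain ⟨y, rfl⟩ := hdiv x
      obtain ⟨z, rfl⟩ := ih y
      exact ⟨z, by rw [pow_succ', mul_smul]⟩
  have key : ∀ {n : ℤ}, n ≠ 0 → Function.Surjective (fun a => n • a : A → A) := by
    intro n hn a
    have hpz : Prime (p : ℤ) := Nat.prime_iff_prime_int.mp hp.out
    have hfm : FiniteMultiplicity (p : ℤ) n :=
      FiniteMultiplicity.of_not_isUnit hpz.not_isUnit hn
    obtain ⟨m, hm, hnd⟩ := hfm.exists_eq_pow_mul_and_not_dvd
    obtain ⟨k, hk⟩ := htor a
    have hc : IsCoprime m ((p : ℤ) ^ k) :=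
      (((Prime.coprime_iff_not_dvd hpz).2 hnd).symm).pow_right
    obtain ⟨u, v, huv⟩ := hc
    obtain ⟨b, hb⟩ := hpow (multiplicity (p : ℤ) n) (u • a)
    refine ⟨b, ?_⟩
    have hb' : ((p : ℤ) ^ (multiplicity (p : ℤ) n)) • b = u • a := by
      rw [← hb, ← natCast_zsmul]; push_cast; rfl
    have hk' : ((p : ℤ) ^ k) • a = 0 := by
      rw [← hk, ← natCast_zsmul]; push_cast; rfl
    change n • b = a
    rw [hm, mul_comm, mul_smul, hb']
    calc m • u • a = (u * m + v * (p : ℤ) ^ k) • a := by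
          rw [add_smul, mul_smul v, hk', smul_zero, add_zero, mul_comm, mul_smul]
      _ = a := by rw [huv, one_smul]
  let _ : DivisibleBy A ℤ := divisibleByOfSMulRightSurj A ℤ key
  exact Module.Baer.of_divisible A

theorem aux_prufer_tor (p : ℕ) [hp : Fact p.Prime] (x : PruferGroup p) :
    ∃ n : ℕ, p ^ n • x = 0 := by
  obtain ⟨x, k, hk⟩ := x
  exact ⟨k, Subtype.ext hk⟩

theorem aux_prufer_div (p : ℕ) [hp : Fact p.Prime] (x : PruferGroup p) :
    ∃ y, p • y = x := by
  have hp0 : (p : ℚ) ≠ 0 := by exact_mod_cast hp.out.ne_zero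
  obtain ⟨x, k, hk⟩ := x
  obtain ⟨q, rfl⟩ := QuotientAddGroup.mk_surjective x
  have h : p • (QuotientAddGroup.mk (q / p) : ℚ ⧸ AddSubgroup.zmultiples (1 : ℚ))
      = QuotientAddGroup.mk q := by
    rw [← QuotientAddGroup.mk_nsmul]
    congr 1
    rw [nsmul_eq_mul]; field_simp
  refine ⟨⟨(QuotientAddGroup.mk (q / p) : ℚ ⧸ AddSubgroup.zmultiples (1 : ℚ)), k + 1, ?_⟩,
    Subtype.ext h⟩
  exact (mul_nsmul' (_ : QModZ) (p ^ k) p).trans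
    ((congrArg (fun t : QModZ => p ^ k • t) h).trans hk)

theorem aux_prufer_socle (p : ℕ) [hp : Fact p.Prime] :
    ∃ φ : ZMod p →+ PruferGroup p, Function.Injective φ ∧
      ∀ x, p • x = 0 → ∃ z, φ z = x := by
  have hp0 : (p : ℚ) ≠ 0 := by exact_mod_cast hp.out.ne_zero
  have h0 : p • (QuotientAddGroup.mk (1 / p) : ℚ ⧸ AddSubgroup.zmultiples (1 : ℚ)) = 0 := by
    rw [← QuotientAddGroup.mk_nsmul, QuotientAddGroup.eq_zero_iff,
      AddSubgroup.mem_zmultiples_iff]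
    refine ⟨1, ?_⟩
    rw [nsmul_eq_mul]; field_simp; simp
  let u : PruferGroup p :=
    ⟨(QuotientAddGroup.mk (1 / p) : ℚ ⧸ AddSubgroup.zmultiples (1 : ℚ)), 1, by
      rw [pow_one]; exact h0⟩
  have hu : zmultiplesHom (PruferGroup p) u (p : ℤ) = 0 := by
    rw [zmultiplesHom_apply, natCast_zsmul]
    exact Subtype.ext h0
  refine ⟨ZMod.lift p ⟨zmultiplesHom _ u, hu⟩, ?_, ?_⟩
  · rw [ZMod.lift_injective]
    intro m hm
    have hm' : m • (QuotientAddGroup.mk (1 / p) : ℚ ⧸ AddSubgroup.zmultiples (1 : ℚ)) = 0 :=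
      congrArg Subtype.val hm
    rw [← QuotientAddGroup.mk_zsmul, QuotientAddGroup.eq_zero_iff,
      AddSubgroup.mem_zmultiples_iff] at hm'
    obtain ⟨j, hj⟩ := hm'
    rw [zsmul_eq_mul, zsmul_eq_mul] at hj
    field_simp at hj
    rw [ZMod.intCast_zmod_eq_zero_iff_dvd]
    exact ⟨j, by rw [mul_comm]; exact_mod_cast hj.symm⟩
  · rintro ⟨x, hx⟩ h
    obtain ⟨q, rfl⟩ := QuotientAddGroup.mk_surjective x
    have h' : p • (QuotientAddGroup.mk q : ℚ ⧸ AddSubgroup.zmultiples (1 : ℚ)) = 0 :=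
      congrArg Subtype.val h
    rw [← QuotientAddGroup.mk_nsmul, QuotientAddGroup.eq_zero_iff,
      AddSubgroup.mem_zmultiples_iff] at h'
    obtain ⟨j, hj⟩ := h'
    refine ⟨(j : ZMod p), ?_⟩
    rw [ZMod.lift_coe]
    apply Subtype.ext
    change j • (QuotientAddGroup.mk (1 / p) : ℚ ⧸ AddSubgroup.zmultiples (1 : ℚ))
      = QuotientAddGroup.mk q
    rw [← QuotientAddGroup.mk_zsmul]
    congr 1
    rw [zsmul_eq_mul, nsmul_eq_mul] at hj
    rw [zsmul_eq_mul]; field_simp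
    linarith

theorem aux_vec (p : ℕ) [hp : Fact p.Prime] (A : Type*) [AddCommGroup A] [Finite A]
    [Module (ZMod p) A] : ∃ k : ℕ, Nonempty (A ≃+ (Fin k → ZMod p)) := by
  have : Module.Finite (ZMod p) A := Module.Finite.of_finite
  exact ⟨_, ⟨(Module.finBasis (ZMod p) A).equivFun.toAddEquiv⟩⟩

theorem aux_divisible (p : ℕ) [hp : Fact p.Prime] (D : Type*) [AddCommGroup D]
    (htor : ∀ x : D, ∃ n : ℕ, p ^ n • x = 0) (hdiv : ∀ x : D, ∃ y, p • y = x)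
    (hfin : {x : D | p • x = 0}.Finite) :
    ∃ k : ℕ, Nonempty (D ≃+ (Fin k → PruferGroup p)) := by
  let S : AddSubgroup D := (nsmulAddMonoidHom (α := D) p).ker
  have hS : ∀ x : D, x ∈ S ↔ p • x = 0 := fun x => Iff.rfl
  have : Finite S := hfin
  let _ : Module (ZMod p) S := AddCommGroup.zmodModule (by
    rintro ⟨x, hx⟩; exact Subtype.ext hx)
  obtain ⟨k, ⟨b⟩⟩ := aux_vec p S
  obtain ⟨φ, hφi, hφs⟩ := aux_prufer_socle p
  let E := Fin k → PruferGroup p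
  have hEtor1 : ∀ x : E, ∃ n : ℕ, p ^ n • x = 0 := by
    intro x
    choose n hn using fun i => aux_prufer_tor p (x i)
    refine ⟨∑ i, n i, funext fun i => ?_⟩
    obtain ⟨c, hc⟩ : p ^ n i ∣ p ^ ∑ i, n i :=
      pow_dvd_pow p (Finset.single_le_sum (f := n) (fun _ _ => Nat.zero_le _) (Finset.mem_univ i))
    change p ^ (∑ i, n i) • x i = 0
    rw [hc, mul_comm, mul_smul, hn, smul_zero]
  have hEdiv : ∀ x : E, ∃ y, p • y = x := by
    intro x
    choose y hy using fun i => aux_prufer_div p (x i)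
    exact ⟨y, funext hy⟩
  have hB : Module.Baer ℤ E := aux_baer p E hEtor1 hEdiv
  let g : S →+ E := (AddMonoidHom.compLeft φ (Fin k)).comp b.toAddMonoidHom
  have hg : ∀ s i, g s i = φ (b s i) := fun _ _ => rfl
  obtain ⟨f, hf⟩ := hB.extension_property_addMonoidHom S.subtype S.subtype_injective g
  have hf' : ∀ s : S, f s = g s := fun s => DFunLike.congr_fun hf s
  refine ⟨k, ⟨AddEquiv.ofBijective f ⟨?_, ?_⟩⟩⟩
  · rw [injective_iff_map_eq_zero]
    have : ∀ n : ℕ, ∀ x : D, p ^ n • x = 0 → f x = 0 → x = 0 := by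
      intro n
      induction n with
      | zero => intro x hx _; simpa using hx
      | succ n ih =>
        intro x hx hfx
        have h1 : p ^ n • x ∈ S := by
          rw [hS, ← mul_smul, ← pow_succ', hx]
        have h2 : g ⟨_, h1⟩ = 0 := by
          rw [← hf', map_nsmul, hfx, smul_zero]
        refine ih x ?_ hfx
        have h3 : (⟨_, h1⟩ : S) = 0 := by
          apply b.injective
          rw [map_zero]
          funext i
          apply hφi
          rw [← hg, h2]; simp; rfl
        exact congrArg Subtype.val h3
    intro x hx
    obtain ⟨n, hn⟩ := htor x
    exact this n x hn hx
  · have hpow : ∀ (k : ℕ) (x : D), ∃ y, p ^ k • y = x := by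
      intro k
      induction k with
      | zero => intro x; exact ⟨x, by simp⟩
      | succ k ih =>
        intro x
        obtain ⟨y, rfl⟩ := hdiv x
        obtain ⟨z, rfl⟩ := ih y
        exact ⟨z, by rw [pow_succ', mul_smul]⟩
    have : ∀ n : ℕ, ∀ y : E, p ^ n • y = 0 → ∃ x, f x = y := by
      intro n
      induction n with
      | zero => intro y hy; exact ⟨0, by simpa using hy.symm⟩
      | succ n ih =>
        intro y hy
        have h1 : p • (p ^ n • y) = 0 := by rw [← mul_smul, ← pow_succ', hy]
        choose z hz using fun i => hφs ((p ^ n • y) i) (congrFun h1 i)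
        have h2 : g (b.symm z) = p ^ n • y := by
          funext i
          rw [hg, AddEquiv.apply_symm_apply, hz]
        obtain ⟨t, ht⟩ := hpow n (b.symm z : S)
        rw [← hf', ← ht, map_nsmul] at h2
        obtain ⟨x, hx⟩ := ih (y - f t) (by rw [smul_sub, h2, sub_self])
        exact ⟨x + t, by rw [map_add, hx, sub_add_cancel]⟩
    intro y
    obtain ⟨n, hn⟩ := hEtor1 y
    exact this n y hn

theorem aux_finite (p : ℕ) [hp : Fact p.Prime] (C : Type*) [AddCommGroup C] [Finite C]
    (htor : ∀ x : C, ∃ n : ℕ, p ^ n • x = 0) :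
    ∃ (n : ℕ) (r : Fin n → ℕ), (∀ i, 1 ≤ r i) ∧
      Nonempty (C ≃+ (∀ i : Fin n, ZMod (p ^ r i))) := by
  classical
  obtain ⟨ι, _, m, hm, ⟨e⟩⟩ := AddCommGroup.equiv_directSum_zmod_of_finite' C
  let e' : C ≃+ (∀ i, ZMod (m i)) := e.trans (DirectSum.addEquivProd _)
  have h : ∀ i, ∃ r, 1 ≤ r ∧ m i = p ^ r := by
    intro i
    obtain ⟨n, hn⟩ := htor (e'.symm (Pi.single i 1))
    have h1 : p ^ n • (Pi.single i 1 : ∀ i, ZMod (m i)) = 0 := by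
      rw [← e'.apply_symm_apply (Pi.single i 1), ← map_nsmul, hn, map_zero]
    have h2 := congrFun h1 i
    rw [Pi.smul_apply, Pi.single_eq_same, nsmul_eq_mul, mul_one, Pi.zero_apply,
      ZMod.natCast_eq_zero_iff] at h2
    obtain ⟨r, -, hr⟩ := (Nat.dvd_prime_pow hp.out).1 h2
    refine ⟨r, ?_, hr⟩
    rcases Nat.eq_zero_or_pos r with h0 | h0
    · have := hm i
      rw [hr, h0] at this; simp at this
    · exact h0
  choose r hr1 hr using h
  obtain rfl : m = fun i => p ^ r i := funext hr
  let σ := Fintype.equivFin ι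
  refine ⟨Fintype.card ι, fun i => r (σ.symm i), fun i => hr1 _, ⟨e'.trans ?_⟩⟩
  exact
    { Equiv.piCongrLeft' (fun i => ZMod (p ^ r i)) σ with
      map_add' := fun _ _ => rfl }

theorem aux_bounded (p N : ℕ) (C : Type*) [AddCommGroup C]
    (hN : ∀ x : C, p ^ N • x = 0) (hfin : {x : C | p • x = 0}.Finite) : Finite C := by
  have : ∀ n : ℕ, {x : C | p ^ n • x = 0}.Finite := by
    intro n
    induction n with
    | zero => simp
    | succ n ih =>
      have h := Set.Finite.preimage' (f := fun x : C => p • x) ih (by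
        intro b _
        by_cases hb : ∃ c : C, p • c = b
        · obtain ⟨c, rfl⟩ := hb
          refine (hfin.image (fun x => x + c)).subset ?_
          intro x hx
          refine ⟨x - c, ?_, by simp⟩
          have hx' : p • x = p • c := hx
          change p • (x - c) = 0
          rw [smul_sub, hx', sub_self]
        · refine Set.finite_empty.subset ?_
          intro x hx
          exact hb ⟨x, hx⟩)
      refine h.subset ?_
      intro x hx
      change p ^ n • p • x = 0
      rw [← mul_smul, ← pow_succ]
      exact hx
  rw [← Set.finite_univ_iff]
  exact (this N).subset fun x _ => hN x

/-- If `P` is a `p`-torsion abelian group and `Hom(ℤ/p, P)` is finite, then `P` is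
isomorphic to a direct sum of finitely many groups, each of which is a cyclic group
`ℤ/p^r` with `r ≥ 1` or a Prüfer `p`-group `ℤ(p^∞)`. -/
theorem p_torsion_decomposition (p : ℕ) [Fact p.Prime] (P : Type*) [AddCommGroup P]
    (htor : ∀ x : P, ∃ n : ℕ, addOrderOf x = p ^ n)
    (hfin : Finite (ZMod p →+ P)) :
    ∃ (n k : ℕ) (r : Fin n → ℕ), (∀ i, 1 ≤ r i) ∧
      Nonempty (P ≃+ ((∀ i : Fin n, ZMod (p ^ r i)) × (Fin k → PruferGroup p))) := by
  classical
  have hp : p.Prime := Fact.out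
  have ht : ∀ x : P, ∃ n : ℕ, p ^ n • x = 0 := fun x => by
    obtain ⟨n, hn⟩ := htor x
    exact ⟨n, by rw [← hn]; exact addOrderOf_nsmul_eq_zero x⟩
  have hsoc : {x : P | p • x = 0}.Finite := by
    refine (Set.finite_range (fun f : ZMod p →+ P => f 1)).subset ?_
    intro x hx
    have hx' : zmultiplesHom P x (p : ℤ) = 0 := by
      rw [zmultiplesHom_apply, natCast_zsmul]; exact hx
    refine ⟨ZMod.lift p ⟨zmultiplesHom P x, hx'⟩, ?_⟩
    have := ZMod.lift_coe p ⟨zmultiplesHom P x, hx'⟩ 1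
    simpa using this
  -- the filtration of the socle stabilizes
  let T : ℕ → Set P := fun n => {x | p • x = 0 ∧ ∃ y, p ^ n • y = x}
  have hTfin : ∀ n, (T n).Finite := fun n => hsoc.subset fun x hx => hx.1
  have hTanti : Antitone T := by
    refine antitone_nat_of_succ_le ?_
    rintro n x ⟨hx, y, rfl⟩
    exact ⟨hx, p • y, by rw [← mul_smul, ← pow_succ]⟩
  obtain ⟨N, hN⟩ : ∃ N, ∀ m, N ≤ m → T m = T N := by
    obtain ⟨N, hN⟩ := exists_minimal_of_wellFoundedLT (fun c : ℕ => ∃ n, (T n).ncard = c)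
      ⟨_, 0, rfl⟩
    obtain ⟨⟨n, hn⟩, hmin⟩ := hN
    refine ⟨n, fun m hm => Set.eq_of_subset_of_ncard_le (hTanti hm) ?_ (hTfin n)⟩
    rw [hn]
    rcases le_total N (T m).ncard with h | h
    · exact h
    · exact hmin ⟨m, rfl⟩ h
  have hdiv0 : ∀ k : ℕ, ∀ x : P, p ^ k • x = 0 → (∃ y, p ^ N • y = x) →
      ∃ y, p ^ (N + 1) • y = x := by
    intro k
    induction k with
    | zero => intro x hx _; exact ⟨0, by simpa using hx.symm⟩
    | succ k ih =>
      rintro x hx ⟨y, rfl⟩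
      have h1 : p ^ k • p ^ N • y ∈ T N :=
        ⟨by rw [← mul_smul, ← pow_succ', hx], p ^ k • y, smul_comm _ _ _⟩
      rw [← hN (N + 1 + k) (by omega)] at h1
      obtain ⟨-, z, hz⟩ := h1
      obtain ⟨w, hw⟩ := ih (p ^ N • y - p ^ (N + 1) • z) (by
        rw [smul_sub, ← hz, ← mul_smul, ← pow_add, add_comm k, sub_self])
        ⟨y - p • z, by rw [smul_sub, ← mul_smul, ← pow_succ]⟩
      exact ⟨w + z, by rw [smul_add, hw, sub_add_cancel]⟩
  let D : Submodule ℤ P := LinearMap.range (nsmulAddMonoidHom (α := P) (p ^ N)).toIntLinearMap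
  have hDmem : ∀ x, x ∈ D ↔ ∃ y, p ^ N • y = x := fun x => Iff.rfl
  have htsub : ∀ (M : Submodule ℤ P) (x : M), ∃ n : ℕ, p ^ n • x = 0 := fun M x => by
    obtain ⟨n, hn⟩ := ht x
    exact ⟨n, Subtype.ext hn⟩
  have hfsub : ∀ (M : Submodule ℤ P), {x : M | p • x = 0}.Finite := fun M => by
    refine Set.Finite.subset (hsoc.preimage (f := fun x : M => (x : P))
      Subtype.val_injective.injOn) ?_
    intro x hx
    exact congrArg Subtype.val hx
  have hDdiv : ∀ x : D, ∃ y, p • y = x := by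
    rintro ⟨x, hx⟩
    obtain ⟨k, hk⟩ := ht x
    obtain ⟨y, hy⟩ := hdiv0 k x hk hx
    refine ⟨⟨p ^ N • y, y, rfl⟩, Subtype.ext ?_⟩
    change p • p ^ N • y = x
    rw [← mul_smul, ← pow_succ', hy]
  obtain ⟨f, hf⟩ := (aux_baer p D (htsub D) hDdiv).extension_property D.subtype
    D.injective_subtype LinearMap.id
  have hcompl : IsCompl D (LinearMap.ker f) := LinearMap.isCompl_of_proj (DFunLike.congr_fun hf)
  obtain ⟨k, ⟨e1⟩⟩ := aux_divisible p D (htsub D) hDdiv (hfsub D)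
  have : Finite (LinearMap.ker f) := aux_bounded p N _ (by
    rintro ⟨x, hx⟩
    apply Subtype.ext
    have h1 : p ^ N • x ∈ D := ⟨x, rfl⟩
    have h2 : p ^ N • x ∈ LinearMap.ker f := (LinearMap.ker f).smul_of_tower_mem _ hx
    exact Submodule.disjoint_def.1 hcompl.disjoint _ h1 h2) (hfsub _)
  obtain ⟨n, r, hr, ⟨e2⟩⟩ := aux_finite p (LinearMap.ker f) (htsub _)
  refine ⟨n, k, r, hr, ⟨?_⟩⟩
  exact ((Submodule.prodEquivOfIsCompl _ _ hcompl).symm.toAddEquiv.trans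
    AddEquiv.prodComm).trans (e2.prodCongr e1)
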